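/- Let Z = ℤ[Θ₁, Θ₂, …, Θ₂₁] be the polynomial ring over ℤ in 21 independent variables. Then there exist 10×10 skew-symmetric matrices A₀, A₁, A₂ with entries in Z such that, in Z[x,y,z], Pf(x·A₀ + y·A₁ + z·A₂) = x⁵Θ₁ + y⁵Θ₂ + z⁵Θ₃ + x⁴yΘ₄ + x³y²Θ₅ + x²y³Θ₆ + xy⁴Θ₇ + x⁴zΘ₈ + x³z²Θ₉ + x²z³Θ₁₀ + xz⁴Θ₁₁ + y⁴zΘ₁₂ + y³z²Θ₁₃ + y²z³Θ₁₄ + yz⁴Θ₁₅ + xyz³Θ₁₆ + xy²z²Θ₁₇ + xy³zΘ₁₈ + x²yz²Θ₁₉ + x²y²zΘ₂₀ + x³yzΘ₂₁; that is, the generic ternary quintic form admits a linear Pfaffian representation over ℤ[Θ₁,…,Θ₂₁]. -/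

import Mathlib

/-- The Pfaffian of a `2n × 2n` skew-symmetric matrix over a commutative ring,
defined recursively by a Laplace-type expansion along the last row. -/
def matrixPfaffian {R : Type*} [CommRing R] :
    (n : ℕ) → Matrix (Fin (2 * n)) (Fin (2 * n)) R → R
  | 0, _ => 1
  | n + 1, M =>
      ∑ j : Fin (2 * n + 1),
        (-1 : R) ^ ((j : ℕ) + 1) * M (Fin.last (2 * n + 1)) j.castSucc *
          matrixPfaffian n (fun a b => M ((j.succAbove a).castSucc) ((j.succAbove b).castSucc))

open MvPolynomial Matrix

set_option maxHeartbeats 1600000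

/-- The polynomial ring `ℤ[Θ₁, …, Θ₂₁]` in 21 independent variables. -/
abbrev ZTheta : Type := MvPolynomial (Fin 21) ℤ

/-- The `i`-th generic coefficient `Θᵢ₊₁`, viewed inside `ℤ[Θ₁,…,Θ₂₁][x,y,z]`. -/
noncomputable def Θ (i : Fin 21) : MvPolynomial (Fin 3) ZTheta := C (X i)

set_option linter.all false
set_option linter.unusedSimpArgs false

/-- The Pfaffian sum of the principal submatrix of `M` on a list of row indices. -/
def listPf {R : Type*} [CommRing R] (M : ℕ → ℕ → R) : ℕ → List ℕ → R
  | 0, _ => 1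
  | n + 1, l => ∑ j ∈ Finset.range (2 * n + 1),
      (-1 : R) ^ (j + 1) * M (l.getD (2 * n + 1) 0) (l.getD j 0) * listPf M n (l.take (2*n+1) |>.eraseIdx j)

theorem listPf_eq {R : Type*} [CommRing R] (M : ℕ → ℕ → R) (n : ℕ) (l : List ℕ) (hl : l.length = 2 * n) :
    matrixPfaffian n (fun a b => M (l.getD a 0) (l.getD b 0)) = listPf M n l := by
  induction n generalizing l with
  | zero => rfl
  | succ n ih =>
    rw [listPf, Finset.sum_range]
    change ∑ j : Fin (2 * n + 1), _ = _
    refine Finset.sum_congr rfl fun j _ => ?_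
    rw [← ih]
    · congr 2
      have key : ∀ a : Fin (2 * n), l.getD ((j.succAbove a).castSucc : Fin (2*n+2)) 0 =
          ((l.take (2*n+1)).eraseIdx j).getD a 0 := by
        intro a
        simp only [List.getD_eq_getElem?_getD, List.getElem?_eraseIdx, List.getElem?_take,
          Fin.succAbove, Fin.lt_def, Fin.val_castSucc]
        have := a.2
        split_ifs <;> first | rfl | omega | simp_all
      funext a b
      change M _ _ = _
      rw [key, key]
    · rw [List.length_eraseIdx_of_lt] <;> simp [hl] <;> omega

theorem listPf_zero {R : Type*} [CommRing R] (M : ℕ → ℕ → R) (l : List ℕ) : listPf M 0 l = 1 := rfl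

theorem listPf_succ_0 {R : Type*} [CommRing R] (M : ℕ → ℕ → R) (l : List ℕ) :
    listPf M 1 l = 0 - M (l.getD 1 0) (l.getD 0 0) *
      listPf M 0 ((l.take 1).eraseIdx 0) := by
  simp [listPf]

theorem listPf_succ_1 {R : Type*} [CommRing R] (M : ℕ → ℕ → R) (l : List ℕ) :
    listPf M 2 l = 0 - M (l.getD 3 0) (l.getD 0 0) *
      listPf M 1 ((l.take 3).eraseIdx 0) + M (l.getD 3 0) (l.getD 1 0) *
      listPf M 1 ((l.take 3).eraseIdx 1) - M (l.getD 3 0) (l.getD 2 0) *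
      listPf M 1 ((l.take 3).eraseIdx 2) := by
  rw [listPf]
  simp only [Finset.sum_range_succ, Finset.sum_range_zero]
  ring

theorem listPf_succ_2 {R : Type*} [CommRing R] (M : ℕ → ℕ → R) (l : List ℕ) :
    listPf M 3 l = 0 - M (l.getD 5 0) (l.getD 0 0) *
      listPf M 2 ((l.take 5).eraseIdx 0) + M (l.getD 5 0) (l.getD 1 0) *
      listPf M 2 ((l.take 5).eraseIdx 1) - M (l.getD 5 0) (l.getD 2 0) *
      listPf M 2 ((l.take 5).eraseIdx 2) + M (l.getD 5 0) (l.getD 3 0) *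
      listPf M 2 ((l.take 5).eraseIdx 3) - M (l.getD 5 0) (l.getD 4 0) *
      listPf M 2 ((l.take 5).eraseIdx 4) := by
  rw [listPf]
  simp only [Finset.sum_range_succ, Finset.sum_range_zero]
  ring

theorem listPf_succ_3 {R : Type*} [CommRing R] (M : ℕ → ℕ → R) (l : List ℕ) :
    listPf M 4 l = 0 - M (l.getD 7 0) (l.getD 0 0) *
      listPf M 3 ((l.take 7).eraseIdx 0) + M (l.getD 7 0) (l.getD 1 0) *
      listPf M 3 ((l.take 7).eraseIdx 1) - M (l.getD 7 0) (l.getD 2 0) *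
      listPf M 3 ((l.take 7).eraseIdx 2) + M (l.getD 7 0) (l.getD 3 0) *
      listPf M 3 ((l.take 7).eraseIdx 3) - M (l.getD 7 0) (l.getD 4 0) *
      listPf M 3 ((l.take 7).eraseIdx 4) + M (l.getD 7 0) (l.getD 5 0) *
      listPf M 3 ((l.take 7).eraseIdx 5) - M (l.getD 7 0) (l.getD 6 0) *
      listPf M 3 ((l.take 7).eraseIdx 6) := by
  rw [listPf]
  simp only [Finset.sum_range_succ, Finset.sum_range_zero]
  ring

theorem listPf_succ_4 {R : Type*} [CommRing R] (M : ℕ → ℕ → R) (l : List ℕ) :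
    listPf M 5 l = 0 - M (l.getD 9 0) (l.getD 0 0) *
      listPf M 4 ((l.take 9).eraseIdx 0) + M (l.getD 9 0) (l.getD 1 0) *
      listPf M 4 ((l.take 9).eraseIdx 1) - M (l.getD 9 0) (l.getD 2 0) *
      listPf M 4 ((l.take 9).eraseIdx 2) + M (l.getD 9 0) (l.getD 3 0) *
      listPf M 4 ((l.take 9).eraseIdx 3) - M (l.getD 9 0) (l.getD 4 0) *
      listPf M 4 ((l.take 9).eraseIdx 4) + M (l.getD 9 0) (l.getD 5 0) *
      listPf M 4 ((l.take 9).eraseIdx 5) - M (l.getD 9 0) (l.getD 6 0) *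
      listPf M 4 ((l.take 9).eraseIdx 6) + M (l.getD 9 0) (l.getD 7 0) *
      listPf M 4 ((l.take 9).eraseIdx 7) - M (l.getD 9 0) (l.getD 8 0) *
      listPf M 4 ((l.take 9).eraseIdx 8) := by
  rw [listPf]
  simp only [Finset.sum_range_succ, Finset.sum_range_zero]
  ring

/-- Strictly upper triangular part of the coefficient matrix of the variable number 0. -/
def upperX {S : Type*} [CommRing S] (t : Fin 21 → S) : ℕ → ℕ → S
  | 0, 3 => t 0
  | 0, 4 => t 3
  | 0, 5 => -t 4
  | 0, 6 => t 5
  | 0, 9 => t 16 + t 9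
  | 1, 2 => 1
  | 2, 3 => t 7
  | 2, 4 => t 20
  | 2, 6 => t 17
  | 2, 8 => t 15
  | 2, 9 => t 13 + t 10
  | 4, 9 => 1
  | 5, 8 => -1
  | 6, 7 => -1
  | _, _ => 0

/-- Strictly upper triangular part of the coefficient matrix of the variable number 1. -/
def upperY {S : Type*} [CommRing S] (t : Fin 21 → S) : ℕ → ℕ → S
  | 0, 2 => -1
  | 0, 6 => t 6
  | 1, 6 => t 1
  | 2, 4 => t 19
  | 2, 6 => t 11
  | 3, 9 => -1
  | 4, 8 => -1
  | 5, 7 => -1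
  | _, _ => 0

/-- Strictly upper triangular part of the coefficient matrix of the variable number 2. -/
def upperZ {S : Type*} [CommRing S] (t : Fin 21 → S) : ℕ → ℕ → S
  | 0, 1 => 1
  | 0, 3 => t 4
  | 0, 7 => t 16 + t 9
  | 2, 3 => t 8
  | 2, 4 => t 18
  | 2, 5 => t 9
  | 2, 6 => t 12
  | 2, 7 => t 13
  | 2, 8 => t 14
  | 2, 9 => t 2
  | 3, 8 => 1
  | 4, 7 => 1
  | 5, 6 => 1
  | _, _ => 0

theorem listPf_explicit {R : Type*} [CommRing R] (M : ℕ → ℕ → R) (x y z : R) (t : Fin 21 → R)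
    (h10 : M 1 0 = -(z * (1)))
    (h20 : M 2 0 = -(y * (-1)))
    (h21 : M 2 1 = -(x * (1)))
    (h30 : M 3 0 = -(x * (t 0) + z * (t 4)))
    (h31 : M 3 1 = 0)
    (h32 : M 3 2 = -(x * (t 7) + z * (t 8)))
    (h40 : M 4 0 = -(x * (t 3)))
    (h41 : M 4 1 = 0)
    (h42 : M 4 2 = -(x * (t 20) + y * (t 19) + z * (t 18)))
    (h43 : M 4 3 = 0)
    (h50 : M 5 0 = -(x * (-t 4)))
    (h51 : M 5 1 = 0)
    (h52 : M 5 2 = -(z * (t 9)))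
    (h53 : M 5 3 = 0)
    (h54 : M 5 4 = 0)
    (h60 : M 6 0 = -(x * (t 5) + y * (t 6)))
    (h61 : M 6 1 = -(y * (t 1)))
    (h62 : M 6 2 = -(x * (t 17) + y * (t 11) + z * (t 12)))
    (h63 : M 6 3 = 0)
    (h64 : M 6 4 = 0)
    (h65 : M 6 5 = -(z * (1)))
    (h70 : M 7 0 = -(z * (t 16 + t 9)))
    (h71 : M 7 1 = 0)
    (h72 : M 7 2 = -(z * (t 13)))
    (h73 : M 7 3 = 0)
    (h74 : M 7 4 = -(z * (1)))
    (h75 : M 7 5 = -(y * (-1)))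
    (h76 : M 7 6 = -(x * (-1)))
    (h80 : M 8 0 = 0)
    (h81 : M 8 1 = 0)
    (h82 : M 8 2 = -(x * (t 15) + z * (t 14)))
    (h83 : M 8 3 = -(z * (1)))
    (h84 : M 8 4 = -(y * (-1)))
    (h85 : M 8 5 = -(x * (-1)))
    (h86 : M 8 6 = 0)
    (h87 : M 8 7 = 0)
    (h90 : M 9 0 = -(x * (t 16 + t 9)))
    (h91 : M 9 1 = 0)
    (h92 : M 9 2 = -(x * (t 13 + t 10) + z * (t 2)))
    (h93 : M 9 3 = -(y * (-1)))
    (h94 : M 9 4 = -(x * (1)))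
    (h95 : M 9 5 = 0)
    (h96 : M 9 6 = 0)
    (h97 : M 9 7 = 0)
    (h98 : M 9 8 = 0)
    : listPf M 5 [0, 1, 2, 3, 4, 5, 6, 7, 8, 9] =
      x^5 * (t 0) +
      y^5 * (t 1) +
      z^5 * (t 2) +
      x^4 * y^1 * (t 3) +
      x^3 * y^2 * (t 4 - t 1 * t 15 * t 0) +
      x^2 * y^3 * (t 5 + t 1 * t 16 * t 7 + t 1 * t 9 * t 7 - t 1 * t 15 * t 3 - t 13 * t 1 * t 0 - t 1 * t 10 * t 0) +
      x^1 * y^4 * (t 6) +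
      x^4 * z^1 * (t 7) +
      x^3 * z^2 * (t 8) +
      x^2 * z^3 * (t 9) +
      x^1 * z^4 * (t 10) +
      y^4 * z^1 * (t 11) +
      y^3 * z^2 * (t 12 + t 1 * t 16 * t 9 + t 1 * t 9 * t 9 - t 2 * t 1 * t 4) +
      y^2 * z^3 * (t 13) +
      y^1 * z^4 * (t 14) +
      x^1 * y^1 * z^3 * (t 15) +
      x^1 * y^2 * z^2 * (t 16 - t 2 * t 1 * t 3) +
      x^1 * y^3 * z^1 * (t 17 + t 1 * t 16 * t 8 + t 1 * t 9 * t 8 - t 1 * t 10 * t 4 - t 14 * t 1 * t 3 - t 2 * t 1 * t 0) +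
      x^2 * y^1 * z^2 * (t 18 - t 2 * t 1 * t 0) +
      x^2 * y^2 * z^1 * (t 19 - t 1 * t 10 * t 3 - t 14 * t 1 * t 0) +
      x^3 * y^1 * z^1 * (t 20 - t 1 * t 10 * t 0) := by
  simp only [listPf_succ_4, List.getD_cons_zero, List.getD_cons_succ, List.take_succ_cons,
    List.eraseIdx_cons_zero, List.eraseIdx_cons_succ, List.take_zero, mul_zero, zero_mul, add_zero, zero_add, sub_zero, zero_sub,
    h10, h20, h21, h30, h31, h32, h40, h41, h42, h43, h50, h51, h52, h53, h54, h60, h61, h62, h63, h64, h65, h70, h71, h72, h73, h74, h75, h76, h80, h81, h82, h83, h84, h85, h86, h87, h90, h91, h92, h93, h94, h95, h96, h97, h98]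
  simp only [listPf_succ_3, List.getD_cons_zero, List.getD_cons_succ, List.take_succ_cons,
    List.eraseIdx_cons_zero, List.eraseIdx_cons_succ, List.take_zero, mul_zero, zero_mul, add_zero, zero_add, sub_zero, zero_sub,
    h10, h20, h21, h30, h31, h32, h40, h41, h42, h43, h50, h51, h52, h53, h54, h60, h61, h62, h63, h64, h65, h70, h71, h72, h73, h74, h75, h76, h80, h81, h82, h83, h84, h85, h86, h87, h90, h91, h92, h93, h94, h95, h96, h97, h98]
  simp only [listPf_succ_2, List.getD_cons_zero, List.getD_cons_succ, List.take_succ_cons,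
    List.eraseIdx_cons_zero, List.eraseIdx_cons_succ, List.take_zero, mul_zero, zero_mul, add_zero, zero_add, sub_zero, zero_sub,
    h10, h20, h21, h30, h31, h32, h40, h41, h42, h43, h50, h51, h52, h53, h54, h60, h61, h62, h63, h64, h65, h70, h71, h72, h73, h74, h75, h76, h80, h81, h82, h83, h84, h85, h86, h87, h90, h91, h92, h93, h94, h95, h96, h97, h98]
  simp only [listPf_succ_1, List.getD_cons_zero, List.getD_cons_succ, List.take_succ_cons,
    List.eraseIdx_cons_zero, List.eraseIdx_cons_succ, List.take_zero, mul_zero, zero_mul, add_zero, zero_add, sub_zero, zero_sub,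
    h10, h20, h21, h30, h31, h32, h40, h41, h42, h43, h50, h51, h52, h53, h54, h60, h61, h62, h63, h64, h65, h70, h71, h72, h73, h74, h75, h76, h80, h81, h82, h83, h84, h85, h86, h87, h90, h91, h92, h93, h94, h95, h96, h97, h98]
  simp only [listPf_succ_0, List.getD_cons_zero, List.getD_cons_succ, List.take_succ_cons,
    List.eraseIdx_cons_zero, List.eraseIdx_cons_succ, List.take_zero, mul_zero, zero_mul, add_zero, zero_add, sub_zero, zero_sub,
    h10, h20, h21, h30, h31, h32, h40, h41, h42, h43, h50, h51, h52, h53, h54, h60, h61, h62, h63, h64, h65, h70, h71, h72, h73, h74, h75, h76, h80, h81, h82, h83, h84, h85, h86, h87, h90, h91, h92, h93, h94, h95, h96, h97, h98]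
  simp only [listPf_zero]
  ring

theorem exists_parameters {S : Type*} [CommRing S] (θ : Fin 21 → S) : ∃ t : Fin 21 → S,
    t 0 = θ 0 ∧
    t 1 = θ 1 ∧
    t 2 = θ 2 ∧
    t 3 = θ 3 ∧
    t 4 - t 1 * t 15 * t 0 = θ 4 ∧
    t 5 + t 1 * t 16 * t 7 + t 1 * t 9 * t 7 - t 1 * t 15 * t 3 - t 13 * t 1 * t 0 - t 1 * t 10 * t 0 = θ 5 ∧
    t 6 = θ 6 ∧
    t 7 = θ 7 ∧
    t 8 = θ 8 ∧
    t 9 = θ 9 ∧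
    t 10 = θ 10 ∧
    t 11 = θ 11 ∧
    t 12 + t 1 * t 16 * t 9 + t 1 * t 9 * t 9 - t 2 * t 1 * t 4 = θ 12 ∧
    t 13 = θ 13 ∧
    t 14 = θ 14 ∧
    t 15 = θ 15 ∧
    t 16 - t 2 * t 1 * t 3 = θ 16 ∧
    t 17 + t 1 * t 16 * t 8 + t 1 * t 9 * t 8 - t 1 * t 10 * t 4 - t 14 * t 1 * t 3 - t 2 * t 1 * t 0 = θ 17 ∧
    t 18 - t 2 * t 1 * t 0 = θ 18 ∧
    t 19 - t 1 * t 10 * t 3 - t 14 * t 1 * t 0 = θ 19 ∧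
    t 20 - t 1 * t 10 * t 0 = θ 20 := by
  let t16 : S := θ 16 + θ 2 * θ 1 * θ 3
  let t18 : S := θ 18 + θ 2 * θ 1 * θ 0
  let t19 : S := θ 19 + θ 1 * θ 10 * θ 3 + θ 14 * θ 1 * θ 0
  let t20 : S := θ 20 + θ 1 * θ 10 * θ 0
  let t4 : S := θ 4 + θ 1 * θ 15 * θ 0
  let t5 : S := θ 5 - θ 1 * t16 * θ 7 - θ 1 * θ 9 * θ 7 + θ 1 * θ 15 * θ 3 + θ 13 * θ 1 * θ 0 + θ 1 * θ 10 * θ 0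
  let t12 : S := θ 12 - θ 1 * t16 * θ 9 - θ 1 * θ 9 * θ 9 + θ 2 * θ 1 * t4
  let t17 : S := θ 17 - θ 1 * t16 * θ 8 - θ 1 * θ 9 * θ 8 + θ 1 * θ 10 * t4 + θ 14 * θ 1 * θ 3 + θ 2 * θ 1 * θ 0
  refine ⟨![θ 0, θ 1, θ 2, θ 3, t4, t5, θ 6, θ 7, θ 8, θ 9, θ 10, θ 11, t12, θ 13, θ 14, θ 15, t16, t17, t18, t19, t20], ?_⟩
  refine ⟨?_, ?_, ?_, ?_, ?_, ?_, ?_, ?_, ?_, ?_, ?_, ?_, ?_, ?_, ?_, ?_, ?_, ?_, ?_, ?_, ?_⟩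
  all_goals simp [t16, t18, t19, t20, t4, t5, t12, t17]
  all_goals ring

/-- The generic ternary quintic form admits a linear Pfaffian representation over
`ℤ[Θ₁, …, Θ₂₁]`. -/
theorem generic_ternary_quintic_admits_linear_pfaffian_representation :
    ∃ A₀ A₁ A₂ : Matrix (Fin (2 * 5)) (Fin (2 * 5)) ZTheta,
      A₀ᵀ = -A₀ ∧ A₁ᵀ = -A₁ ∧ A₂ᵀ = -A₂ ∧
      matrixPfaffian 5
        ((X 0 : MvPolynomial (Fin 3) ZTheta) • A₀.map C +
          (X 1 : MvPolynomial (Fin 3) ZTheta) • A₁.map C +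
          (X 2 : MvPolynomial (Fin 3) ZTheta) • A₂.map C) =
        X 0 ^ 5 * Θ 0 + X 1 ^ 5 * Θ 1 + X 2 ^ 5 * Θ 2 +
        X 0 ^ 4 * X 1 * Θ 3 + X 0 ^ 3 * X 1 ^ 2 * Θ 4 + X 0 ^ 2 * X 1 ^ 3 * Θ 5 +
        X 0 * X 1 ^ 4 * Θ 6 + X 0 ^ 4 * X 2 * Θ 7 + X 0 ^ 3 * X 2 ^ 2 * Θ 8 +
        X 0 ^ 2 * X 2 ^ 3 * Θ 9 + X 0 * X 2 ^ 4 * Θ 10 +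
        X 1 ^ 4 * X 2 * Θ 11 + X 1 ^ 3 * X 2 ^ 2 * Θ 12 + X 1 ^ 2 * X 2 ^ 3 * Θ 13 +
        X 1 * X 2 ^ 4 * Θ 14 + X 0 * X 1 * X 2 ^ 3 * Θ 15 + X 0 * X 1 ^ 2 * X 2 ^ 2 * Θ 16 +
        X 0 * X 1 ^ 3 * X 2 * Θ 17 + X 0 ^ 2 * X 1 * X 2 ^ 2 * Θ 18 +
        X 0 ^ 2 * X 1 ^ 2 * X 2 * Θ 19 + X 0 ^ 3 * X 1 * X 2 * Θ 20 := by
  obtain ⟨t, e0, e1, e2, e3, e4, e5, e6, e7, e8, e9, e10, e11, e12, e13, e14, e15, e16, e17, e18, e19, e20⟩ := exists_parameters (fun i => (X i : ZTheta))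
  refine ⟨fun i j => upperX t i j - upperX t j i, fun i j => upperY t i j - upperY t j i,
    fun i j => upperZ t i j - upperZ t j i, ?_, ?_, ?_, ?_⟩
  · ext1 i j; exact (neg_sub _ _).symm
  · ext1 i j; exact (neg_sub _ _).symm
  · ext1 i j; exact (neg_sub _ _).symm
  let M : ℕ → ℕ → MvPolynomial (Fin 3) ZTheta := fun i j =>
    X 0 * C (upperX t i j - upperX t j i) + X 1 * C (upperY t i j - upperY t j i) +
      X 2 * C (upperZ t i j - upperZ t j i)
  have hM := listPf_eq M 5 [0, 1, 2, 3, 4, 5, 6, 7, 8, 9] rfl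
  have hE := listPf_explicit M (X 0) (X 1) (X 2) (fun i => C (t i))
    (by simp [M, upperX, upperY, upperZ]; try ring)
    (by simp [M, upperX, upperY, upperZ]; try ring)
    (by simp [M, upperX, upperY, upperZ]; try ring)
    (by simp [M, upperX, upperY, upperZ]; try ring)
    (by simp [M, upperX, upperY, upperZ]; try ring)
    (by simp [M, upperX, upperY, upperZ]; try ring)
    (by simp [M, upperX, upperY, upperZ]; try ring)
    (by simp [M, upperX, upperY, upperZ]; try ring)
    (by simp [M, upperX, upperY, upperZ]; try ring)
    (by simp [M, upperX, upperY, upperZ]; try ring)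
    (by simp [M, upperX, upperY, upperZ]; try ring)
    (by simp [M, upperX, upperY, upperZ]; try ring)
    (by simp [M, upperX, upperY, upperZ]; try ring)
    (by simp [M, upperX, upperY, upperZ]; try ring)
    (by simp [M, upperX, upperY, upperZ]; try ring)
    (by simp [M, upperX, upperY, upperZ]; try ring)
    (by simp [M, upperX, upperY, upperZ]; try ring)
    (by simp [M, upperX, upperY, upperZ]; try ring)
    (by simp [M, upperX, upperY, upperZ]; try ring)
    (by simp [M, upperX, upperY, upperZ]; try ring)
    (by simp [M, upperX, upperY, upperZ]; try ring)
    (by simp [M, upperX, upperY, upperZ]; try ring)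
    (by simp [M, upperX, upperY, upperZ]; try ring)
    (by simp [M, upperX, upperY, upperZ]; try ring)
    (by simp [M, upperX, upperY, upperZ]; try ring)
    (by simp [M, upperX, upperY, upperZ]; try ring)
    (by simp [M, upperX, upperY, upperZ]; try ring)
    (by simp [M, upperX, upperY, upperZ]; try ring)
    (by simp [M, upperX, upperY, upperZ]; try ring)
    (by simp [M, upperX, upperY, upperZ]; try ring)
    (by simp [M, upperX, upperY, upperZ]; try ring)
    (by simp [M, upperX, upperY, upperZ]; try ring)
    (by simp [M, upperX, upperY, upperZ]; try ring)
    (by simp [M, upperX, upperY, upperZ]; try ring)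
    (by simp [M, upperX, upperY, upperZ]; try ring)
    (by simp [M, upperX, upperY, upperZ]; try ring)
    (by simp [M, upperX, upperY, upperZ]; try ring)
    (by simp [M, upperX, upperY, upperZ]; try ring)
    (by simp [M, upperX, upperY, upperZ]; try ring)
    (by simp [M, upperX, upperY, upperZ]; try ring)
    (by simp [M, upperX, upperY, upperZ]; try ring)
    (by simp [M, upperX, upperY, upperZ]; try ring)
    (by simp [M, upperX, upperY, upperZ]; try ring)
    (by simp [M, upperX, upperY, upperZ]; try ring)
    (by simp [M, upperX, upperY, upperZ]; try ring)
  have hg : ∀ a : Fin (2 * 5), ([0, 1, 2, 3, 4, 5, 6, 7, 8, 9] : List ℕ).getD a 0 = a := by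
    intro a; fin_cases a <;> rfl
  simp only [hg] at hM
  rw [hE] at hM
  refine Eq.trans ?_ (hM.trans ?_)
  · rfl
  · simp only [Θ, ← e0, ← e1, ← e2, ← e3, ← e4, ← e5, ← e6, ← e7, ← e8, ← e9, ← e10, ← e11, ← e12, ← e13, ← e14, ← e15, ← e16, ← e17, ← e18, ← e19, ← e20]
    simp only [map_add, map_sub, map_mul]
    ring
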